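/- Let ℋ be a finite-dimensional complex Hilbert space with dim ℋ ≥ 2, let κ ∈ (0,∞), let α ∈ (1,∞) satisfy (1−κ)α < 1, and let z ∈ (0,∞). Then the following are equivalent: (1) D_{α,z} is continuous on (B(ℋ)×B(ℋ))_{λ,κ'} for every λ > 0 and every κ' ∈ [κ,∞); (2) D_{α,z} is continuous on (B(ℋ)×B(ℋ))_{λ,κ} for every λ > 0; (3) D_{α,z} is continuous on (B(ℋ)×B(ℋ))_{λ,κ} for some λ > 0; (4) D_{α,z} is continuous on ([0,cI]×[0,cI])_{λ,κ} for every λ > 0 and c > 0; (5) D_{α,z} is continuous on ([0,cI]×[0,cI])_{λ,κ} for some λ > 0 and c > 0; (6) D_{α,z} is continuous on (S(ℋ)×S(ℋ))_{λ,κ} for every λ > 1; (7) D_{α,z} is continuous on (S(ℋ)×S(ℋ))_{λ,κ} for some λ > 1; (8) z > (α−1)/κ. -/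

import Mathlib

open Filter Set Topology
open scoped ComplexOrder

noncomputable section

namespace QRenyi

attribute [local instance] Classical.propDecidable

variable {ι : Type*} [Fintype ι] [DecidableEq ι]

/-- Apply a real function to the eigenvalues of a Hermitian matrix (functional calculus);
junk value `0` for non-Hermitian matrices. -/
noncomputable def hermApply (f : ℝ → ℝ) (A : Matrix ι ι ℂ) : Matrix ι ι ℂ :=
  if hA : A.IsHermitian then hA.cfc f else 0

/-- Real power of a positive semidefinite matrix, taken on its support:
`t ↦ t ^ x` is applied to the nonzero eigenvalues and `0` is mapped to `0`.
In particular `matPow A 0` is the support projection of `A`. -/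
noncomputable def matPow (A : Matrix ι ι ℂ) (x : ℝ) : Matrix ι ι ℂ :=
  hermApply (fun t => if t = 0 then 0 else t ^ x) A

/-- Logarithm of a positive semidefinite matrix taken on its support
(`Real.log 0 = 0` in Mathlib, matching the convention `log̃ 0 = 0`). -/
noncomputable def matLog (A : Matrix ι ι ℂ) : Matrix ι ι ℂ :=
  hermApply Real.log A

/-- `supp ρ ≤ supp σ`, expressed (for PSD matrices) as inclusion of kernels. -/
def suppLE (ρ σ : Matrix ι ι ℂ) : Prop :=
  ∀ v : ι → ℂ, σ.mulVec v = 0 → ρ.mulVec v = 0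

/-- The Loewner (positive semidefinite) order. -/
def loewnerLE (A B : Matrix ι ι ℂ) : Prop := (B - A).PosSemidef

/-- Real part of the trace. -/
noncomputable def reTrace (A : Matrix ι ι ℂ) : ℝ := A.trace.re

/-- The trace quantity `Tr ((σ^{(1-α)/(2z)} ρ^{α/z} σ^{(1-α)/(2z)})^z)` (a real number). -/
noncomputable def Qaz (α z : ℝ) (ρ σ : Matrix ι ι ℂ) : ℝ :=
  reTrace (matPow (matPow σ ((1 - α) / (2 * z)) * matPow ρ (α / z) *
    matPow σ ((1 - α) / (2 * z))) z)

/-- The Rényi `(α,z)`-divergence (for `α ≠ 1`), with values in `EReal = ℝ ∪ {±∞}`.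
It equals `(α-1)⁻¹ (log Q_{α,z}(ρ‖σ) - log Tr ρ)`; it is `+∞` when `α > 1` and
`supp ρ ≰ supp σ`, and also `+∞` when `α < 1` and `Q_{α,z}(ρ‖σ) = 0`
(i.e. `(α-1)⁻¹ log 0 = +∞`). -/
noncomputable def Daz (α z : ℝ) (ρ σ : Matrix ι ι ℂ) : EReal :=
  if (suppLE ρ σ ∨ α < 1) ∧ Qaz α z ρ σ ≠ 0 then
    (((α - 1)⁻¹ * (Real.log (Qaz α z ρ σ) - Real.log (reTrace ρ)) : ℝ) : EReal)
  else ⊤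

/-- The (normalized) Umegaki relative entropy. -/
noncomputable def DUm (ρ σ : Matrix ι ι ℂ) : EReal :=
  if suppLE ρ σ then
    (((reTrace ρ)⁻¹ * reTrace (ρ * (matLog ρ - matLog σ)) : ℝ) : EReal)
  else ⊤

/-- The Rényi `(α,z)`-divergence, with `D_{1,z} := D^Um`. -/
noncomputable def Dfull (α z : ℝ) (ρ σ : Matrix ι ι ℂ) : EReal :=
  if α = 1 then DUm ρ σ else Daz α z ρ σ

/-- The max-relative entropy `D_max(ρ‖σ) = log inf {λ > 0 : ρ ≤ λ σ}`. -/
noncomputable def Dmax (ρ σ : Matrix ι ι ℂ) : EReal :=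
  if ∃ c : ℝ, 0 < c ∧ loewnerLE ρ (c • σ) then
    ((Real.log (sInf {c : ℝ | 0 < c ∧ loewnerLE ρ (c • σ)}) : ℝ) : EReal)
  else ⊤

/-- The classical quantity `Q_α^cl(ρ‖σ) = ∑_x ρ(x)^α σ(x)^{1-α}` (with `0^t = 0` for `t ≠ 0`). -/
noncomputable def Qcl {X : Type*} [Fintype X] (α : ℝ) (ρ σ : X → ℝ) : ℝ :=
  ∑ x, ρ x ^ α * σ x ^ (1 - α)

/-- Absolute continuity `ρ ≪ σ` for functions on a finite set. -/
def acl {X : Type*} (ρ σ : X → ℝ) : Prop := ∀ x, σ x = 0 → ρ x = 0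

/-- The classical Rényi `α`-divergence, with values in `EReal`; for `α = 1` it is the
(normalized) Kullback-Leibler divergence. -/
noncomputable def Dcl {X : Type*} [Fintype X] (α : ℝ) (ρ σ : X → ℝ) : EReal :=
  if α = 1 then
    (if acl ρ σ then
      ((((∑ x, ρ x)⁻¹ * ∑ x, ρ x * (Real.log (ρ x) - Real.log (σ x))) : ℝ) : EReal)
     else ⊤)
  else if (acl ρ σ ∨ α < 1) ∧ Qcl α ρ σ ≠ 0 then
    ((((α - 1)⁻¹ * (Real.log (Qcl α ρ σ) - Real.log (∑ x, ρ x))) : ℝ) : EReal)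
  else ⊤

/-- The measured Rényi `α`-divergence: supremum over all finite-outcome POVMs. -/
noncomputable def Dmeas (α : ℝ) (ρ σ : Matrix ι ι ℂ) : EReal :=
  ⨆ (k : ℕ) (M : Fin k → Matrix ι ι ℂ)
    (_ : (∀ i, (M i).PosSemidef) ∧ ∑ i, M i = 1),
    Dcl α (fun i => reTrace (M i * ρ)) (fun i => reTrace (M i * σ))

/-- A `κ`-function: a continuous nonnegative function on `[0,∞)` with
`limsup_{x→0⁺} f(x) x^{-κ} < ∞`. -/
def IsKappaFunction (κ : ℝ) (f : ℝ → ℝ) : Prop :=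
  ContinuousOn f (Set.Ici 0) ∧ (∀ x ∈ Set.Ici (0 : ℝ), 0 ≤ f x) ∧
    ∃ M : ℝ, ∀ᶠ x in 𝓝[>] (0 : ℝ), f x ≤ M * x ^ κ

/-- A strict `κ`-function: a `κ`-function with `liminf_{x→0⁺} f(x) x^{-κ} > 0`. -/
def IsStrictKappaFunction (κ : ℝ) (f : ℝ → ℝ) : Prop :=
  IsKappaFunction κ f ∧ ∃ c : ℝ, 0 < c ∧ ∀ᶠ x in 𝓝[>] (0 : ℝ), c * x ^ κ ≤ f x

/-- Nonzero PSD matrix predicate. -/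
def PSDne (A : Matrix ι ι ℂ) : Prop := A.PosSemidef ∧ A ≠ 0


/-- The set `(B(ℋ)×B(ℋ))_{λ,κ}` of pairs of nonzero PSD matrices with `ρ ≤ λ σ^κ`. -/
def BsetLK (n : ℕ) (lam κ : ℝ) :
    Set (Matrix (Fin n) (Fin n) ℂ × Matrix (Fin n) (Fin n) ℂ) :=
  {p | PSDne p.1 ∧ PSDne p.2 ∧ loewnerLE p.1 (lam • matPow p.2 κ)}

/-- The set `([0,cI]×[0,cI])_{λ,κ}`. -/
def CsetLK (n : ℕ) (lam κ c : ℝ) :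
    Set (Matrix (Fin n) (Fin n) ℂ × Matrix (Fin n) (Fin n) ℂ) :=
  {p ∈ BsetLK n lam κ |
    loewnerLE p.1 (c • (1 : Matrix (Fin n) (Fin n) ℂ)) ∧
    loewnerLE p.2 (c • (1 : Matrix (Fin n) (Fin n) ℂ))}

/-- The set `(S(ℋ)×S(ℋ))_{λ,κ}` of pairs of density matrices with `ρ ≤ λ σ^κ`. -/
def SsetLK (n : ℕ) (lam κ : ℝ) :
    Set (Matrix (Fin n) (Fin n) ℂ × Matrix (Fin n) (Fin n) ℂ) :=
  {p ∈ BsetLK n lam κ | p.1.trace = 1 ∧ p.2.trace = 1}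


section MatPow

open scoped Matrix MatrixOrder Matrix.Norms.L2Operator

/-- The scalar function underlying `matPow`. -/
def suppRpow (x t : ℝ) : ℝ := if t = 0 then 0 else t ^ x

lemma suppRpow_zero_right (x : ℝ) : suppRpow x 0 = 0 := by simp [suppRpow]

lemma suppRpow_of_ne {t : ℝ} (x : ℝ) (ht : t ≠ 0) : suppRpow x t = t ^ x := by
  simp [suppRpow, ht]

lemma suppRpow_eq_rpow {x : ℝ} (hx : x ≠ 0) : suppRpow x = fun t => t ^ x := by
  ext t
  rcases eq_or_ne t 0 with rfl | ht
  · simp [suppRpow, Real.zero_rpow hx]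
  · simp [suppRpow, ht]

lemma suppRpow_nonneg (x : ℝ) {t : ℝ} (ht : 0 ≤ t) : 0 ≤ suppRpow x t := by
  unfold suppRpow
  split_ifs <;> positivity

lemma suppRpow_mul_suppRpow (x y : ℝ) {t : ℝ} (ht : 0 ≤ t) :
    suppRpow x t * suppRpow y t = suppRpow (x + y) t := by
  rcases ht.eq_or_lt' with rfl | h
  · simp [suppRpow]
  · simp [suppRpow, h.ne', Real.rpow_add h]

lemma suppRpow_suppRpow (x y : ℝ) {t : ℝ} (ht : 0 ≤ t) :
    suppRpow y (suppRpow x t) = suppRpow (x * y) t := by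
  rcases ht.eq_or_lt' with rfl | h
  · simp [suppRpow]
  · simp [suppRpow, h.ne', Real.rpow_mul h.le, (Real.rpow_pos_of_pos h x).ne']

lemma suppRpow_mul (x : ℝ) {r t : ℝ} (hr : 0 ≤ r) (ht : 0 ≤ t) :
    suppRpow x (r * t) = suppRpow x r * suppRpow x t := by
  rcases ht.eq_or_lt' with rfl | h
  · simp [suppRpow]
  rcases hr.eq_or_lt' with rfl | h'
  · simp [suppRpow]
  · simp [suppRpow, h.ne', h'.ne', Real.mul_rpow h'.le h.le]

lemma continuousOn_spectrum (A : Matrix ι ι ℂ) (f : ℝ → ℝ) :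
    ContinuousOn f (spectrum ℝ A) :=
  A.finite_real_spectrum.continuousOn f

lemma spectrum_nonneg {A : Matrix ι ι ℂ} (hA : A.PosSemidef) {t : ℝ}
    (ht : t ∈ spectrum ℝ A) : 0 ≤ t :=
  spectrum_nonneg_of_nonneg (Matrix.nonneg_iff_posSemidef.2 hA) ht

lemma matPow_eq_cfc {A : Matrix ι ι ℂ} (hA : A.IsHermitian) (x : ℝ) :
    matPow A x = cfc (suppRpow x) A := by
  rw [hA.cfc_eq]
  simp only [matPow, hermApply, hA, dif_pos]
  rfl

lemma posSemidef_cfc {A : Matrix ι ι ℂ} (hA : A.PosSemidef) {f : ℝ → ℝ}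
    (hf : ∀ t, 0 ≤ t → 0 ≤ f t) : (cfc f A).PosSemidef :=
  Matrix.nonneg_iff_posSemidef.1 (cfc_nonneg fun _ ht => hf _ (spectrum_nonneg hA ht))

lemma posSemidef_matPow {A : Matrix ι ι ℂ} (hA : A.PosSemidef) (x : ℝ) :
    (matPow A x).PosSemidef := by
  rw [matPow_eq_cfc hA.1]
  exact posSemidef_cfc hA fun _ => suppRpow_nonneg x

lemma matPow_mul_matPow {A : Matrix ι ι ℂ} (hA : A.PosSemidef) (x y : ℝ) :
    matPow A x * matPow A y = matPow A (x + y) := by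
  simp only [matPow_eq_cfc hA.1]
  rw [← cfc_mul _ _ A (continuousOn_spectrum _ _) (continuousOn_spectrum _ _)]
  exact cfc_congr fun t ht => suppRpow_mul_suppRpow x y (spectrum_nonneg hA ht)

lemma matPow_matPow {A : Matrix ι ι ℂ} (hA : A.PosSemidef) (x y : ℝ) :
    matPow (matPow A x) y = matPow A (x * y) := by
  rw [matPow_eq_cfc (posSemidef_matPow hA x).1, matPow_eq_cfc hA.1, matPow_eq_cfc hA.1]
  refine (cfc_comp' _ _ A ((A.finite_real_spectrum.image _).continuousOn _)
      (continuousOn_spectrum _ _) hA.1).symm.trans ?_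
  exact cfc_congr fun t ht => suppRpow_suppRpow x y (spectrum_nonneg hA ht)

lemma posSemidef_real_smul {A : Matrix ι ι ℂ} (hA : A.PosSemidef) {r : ℝ} (hr : 0 ≤ r) :
    (r • A).PosSemidef :=
  Matrix.nonneg_iff_posSemidef.1 (smul_nonneg hr (Matrix.nonneg_iff_posSemidef.2 hA))

lemma matPow_smul {A : Matrix ι ι ℂ} (hA : A.PosSemidef) {r : ℝ} (hr : 0 ≤ r) (x : ℝ) :
    matPow (r • A) x = suppRpow x r • matPow A x := by
  rw [matPow_eq_cfc (posSemidef_real_smul hA hr).1, matPow_eq_cfc hA.1,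
    ← cfc_smul _ _ A (continuousOn_spectrum _ _)]
  refine (cfc_comp_smul r _ A ((A.finite_real_spectrum.image _).continuousOn _) hA.1).symm.trans ?_
  exact cfc_congr fun t ht => by
    simpa using suppRpow_mul x hr (spectrum_nonneg hA ht)

lemma matPow_one {A : Matrix ι ι ℂ} (hA : A.PosSemidef) : matPow A 1 = A := by
  rw [matPow_eq_cfc hA.1, suppRpow_eq_rpow one_ne_zero]
  simp only [Real.rpow_one]
  exact cfc_id' ℝ A hA.1

lemma matPow_eq_rpow {A : Matrix ι ι ℂ} (hA : A.PosSemidef) {x : ℝ} (hx : x ≠ 0) :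
    matPow A x = A ^ x := by
  rw [matPow_eq_cfc hA.1, suppRpow_eq_rpow hx,
    CFC.rpow_eq_cfc_real (Matrix.nonneg_iff_posSemidef.2 hA)]

lemma matPow_eq_zero_iff {A : Matrix ι ι ℂ} (hA : A.PosSemidef) (x : ℝ) :
    matPow A x = 0 ↔ A = 0 := by
  constructor
  · intro h
    rw [← matPow_one hA, ← add_sub_cancel x 1, ← matPow_mul_matPow hA, h, zero_mul]
  · rintro rfl
    rw [matPow_eq_cfc Matrix.isHermitian_zero, cfc_apply_zero, suppRpow_zero_right, map_zero]

lemma matPow_le_matPow {A B : Matrix ι ι ℂ} (hA : A.PosSemidef) (hB : B.PosSemidef)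
    (hAB : A ≤ B) {x : ℝ} (hx : 0 < x) (hx1 : x ≤ 1) : matPow A x ≤ matPow B x := by
  rw [matPow_eq_rpow hA hx.ne', matPow_eq_rpow hB hx.ne']
  exact CFC.rpow_le_rpow ⟨hx.le, hx1⟩ hAB

lemma matPow_le_smul_matPow {A : Matrix ι ι ℂ} (hA : A.PosSemidef) {R : ℝ} (hR : ‖A‖ ≤ R)
    {x y : ℝ} (hyx : y ≤ x) : matPow A x ≤ R ^ (x - y) • matPow A y := by
  rw [matPow_eq_cfc hA.1, matPow_eq_cfc hA.1, ← cfc_smul _ _ A (continuousOn_spectrum _ _)]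
  refine cfc_mono (fun t ht => ?_) (continuousOn_spectrum _ _) (continuousOn_spectrum _ _)
  have ht0 := spectrum_nonneg hA ht
  have : Nontrivial (Matrix ι ι ℂ) := by
    by_contra h
    rw [not_nontrivial_iff_subsingleton] at h
    simp [spectrum.of_subsingleton] at ht
  have htR : t ≤ R := by
    refine le_trans ?_ hR
    simpa [abs_of_nonneg ht0] using spectrum.norm_le_norm_of_mem ht
  rw [show x = (x - y) + y by ring, ← suppRpow_mul_suppRpow _ _ ht0, smul_eq_mul,
    add_sub_cancel_right]
  rcases ht0.eq_or_lt' with rfl | h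
  · simp [suppRpow]
  · rw [suppRpow_of_ne _ h.ne', suppRpow_of_ne _ h.ne']
    gcongr

lemma continuousOn_cfc_posSemidef {f : ℝ → ℝ} (hf : Continuous f) :
    ContinuousOn (fun A : Matrix ι ι ℂ => cfc f A) {A | A.PosSemidef} :=
  ContinuousOn.cfc_of_mem_nhdsSet (s := univ) f univ_mem continuousOn_id
    (fun _ hA => hA.1) hf.continuousOn

lemma continuousOn_matPow {x : ℝ} (hx : 0 < x) :
    ContinuousOn (fun A : Matrix ι ι ℂ => matPow A x) {A | A.PosSemidef} := by
  refine (continuousOn_cfc_posSemidef (f := suppRpow x) ?_).congr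
    fun A hA => matPow_eq_cfc hA.1 x
  rw [suppRpow_eq_rpow hx.ne']
  exact Real.continuous_rpow_const hx.le

lemma matPow_le_smul_matPow_of_le {ρ σ : Matrix ι ι ℂ} (hρ : ρ.PosSemidef)
    (hσ : σ.PosSemidef) {κ L R x β : ℝ} (hL : 0 < L) (h : ρ ≤ L • matPow σ κ)
    (hR : ‖ρ‖ ≤ R) (hβ : 0 < β) (hβ1 : β ≤ 1) (hβx : β ≤ x) :
    matPow ρ x ≤ (R ^ (x - β) * L ^ β) • matPow σ (κ * β) := by
  have hR0 : 0 ≤ R := (norm_nonneg _).trans hR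
  refine (matPow_le_smul_matPow hρ hR hβx).trans ?_
  rw [mul_smul]
  refine smul_le_smul_of_nonneg_left ?_ (Real.rpow_nonneg hR0 _)
  refine (matPow_le_matPow hρ (posSemidef_real_smul (posSemidef_matPow hσ κ) hL.le) h
    hβ hβ1).trans_eq ?_
  rw [matPow_smul (posSemidef_matPow hσ κ) hL.le, suppRpow_of_ne _ hL.ne', matPow_matPow hσ]

lemma norm_matPow_mul_cfc_sq_le {ρ σ : Matrix ι ι ℂ} (hρ : ρ.PosSemidef)
    (hσ : σ.PosSemidef) {κ L R a β M : ℝ} (hL : 0 < L) (h : ρ ≤ L • matPow σ κ)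
    (hR : ‖ρ‖ ≤ R) (hβ : 0 < β) (hβ1 : β ≤ 1) (hβa : β ≤ a + a) {k : ℝ → ℝ}
    (hk : ∀ t, 0 ≤ t → k t * suppRpow (κ * β) t * k t ≤ M) :
    ‖matPow ρ a * cfc k σ‖ ^ 2 ≤ R ^ (a + a - β) * L ^ β * M := by
  have hR0 : 0 ≤ R := (norm_nonneg _).trans hR
  have hC : 0 ≤ R ^ (a + a - β) * L ^ β :=
    mul_nonneg (Real.rpow_nonneg hR0 _) (Real.rpow_nonneg hL.le _)
  have hk0 : ∀ t, 0 ≤ t → 0 ≤ k t * suppRpow (κ * β) t * k t := fun t ht => by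
    rw [mul_right_comm]
    exact mul_nonneg (mul_self_nonneg _) (suppRpow_nonneg _ ht)
  have hM : 0 ≤ M := (hk0 0 le_rfl).trans (hk 0 le_rfl)
  have hK : star (cfc k σ) = cfc k σ := (cfc_predicate k σ : IsSelfAdjoint _).star_eq
  have hstar : star (matPow ρ a * cfc k σ) * (matPow ρ a * cfc k σ)
      = star (cfc k σ) * matPow ρ (a + a) * cfc k σ := by
    rw [star_mul, ← matPow_mul_matPow hρ, Matrix.star_eq_conjTranspose (matPow ρ a),
      (posSemidef_matPow hρ a).1.eq]
    simp only [mul_assoc]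
  rw [sq, ← CStarRing.norm_star_mul_self, hstar]
  have hle := star_left_conjugate_le_conjugate
    (matPow_le_smul_matPow_of_le hρ hσ hL h hR hβ hβ1 hβa) (cfc k σ)
  have hnn : 0 ≤ star (cfc k σ) * matPow ρ (a + a) * cfc k σ := by
    rw [← hstar]
    exact star_mul_self_nonneg _
  refine (CStarAlgebra.norm_le_norm_of_nonneg_of_le hnn hle).trans ?_
  have hprod : cfc k σ * matPow σ (κ * β) * cfc k σ
      = cfc (fun t => k t * suppRpow (κ * β) t * k t) σ := by
    rw [matPow_eq_cfc hσ.1, cfc_mul _ _ σ (continuousOn_spectrum _ _) (continuousOn_spectrum _ _),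
      cfc_mul _ _ σ (continuousOn_spectrum _ _) (continuousOn_spectrum _ _)]
  rw [hK, mul_smul_comm, smul_mul_assoc, hprod, norm_smul, Real.norm_of_nonneg hC]
  refine mul_le_mul_of_nonneg_left (norm_cfc_le hM fun t ht => ?_) hC
  have ht0 := spectrum_nonneg hσ ht
  rw [Real.norm_of_nonneg (hk0 t ht0)]
  exact hk t ht0

/-- Truncating the singular power `t ^ (-b)` below `ε` changes it, weighted by `t ^ c`,
by at most `ε ^ (c - 2 * b)`. -/
lemma suppRpow_truncation_le {b c ε t : ℝ} (hb : 0 < b) (hbc : 2 * b < c) (hε : 0 < ε)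
    (ht : 0 ≤ t) :
    (suppRpow (-b) t - max t ε ^ (-b)) * suppRpow c t * (suppRpow (-b) t - max t ε ^ (-b))
      ≤ ε ^ (c - 2 * b) := by
  rcases ht.eq_or_lt' with rfl | h
  · simp only [suppRpow_zero_right, mul_zero, zero_mul]
    positivity
  rcases le_or_gt ε t with hεt | hεt
  · rw [max_eq_left hεt, suppRpow_of_ne _ h.ne', sub_self, zero_mul, zero_mul]
    positivity
  · rw [max_eq_right hεt.le, suppRpow_of_ne _ h.ne', suppRpow_of_ne _ h.ne']
    have h1 : ε ^ (-b) ≤ t ^ (-b) := Real.rpow_le_rpow_of_nonpos h hεt.le (by linarith)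
    have h2 : 0 ≤ ε ^ (-b) := by positivity
    have h3 : 0 ≤ t ^ c := by positivity
    calc (t ^ (-b) - ε ^ (-b)) * t ^ c * (t ^ (-b) - ε ^ (-b))
        ≤ t ^ (-b) * t ^ c * t ^ (-b) := by
          gcongr <;> linarith
      _ = t ^ (c - 2 * b) := by
          rw [← Real.rpow_add h, ← Real.rpow_add h]
          ring_nf
      _ ≤ ε ^ (c - 2 * b) := Real.rpow_le_rpow h.le hεt.le (by linarith)

lemma continuousOn_matPow_mul_matPow_neg {a b κ L : ℝ} (ha : 0 < a) (hb : 0 < b)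
    (hL : 0 < L) {β : ℝ} (hβ : 0 < β) (hβ1 : β ≤ 1) (hβa : β ≤ a + a)
    (hbβ : 2 * b < κ * β) :
    ContinuousOn (fun p : Matrix ι ι ℂ × Matrix ι ι ℂ => matPow p.1 a * matPow p.2 (-b))
      {p | p.1.PosSemidef ∧ p.2.PosSemidef ∧ p.1 ≤ L • matPow p.2 κ} := by
  refine continuousOn_of_locally_continuousOn fun p₀ _ => ?_
  set R := ‖p₀.1‖ + 1
  have hR0 : 0 < R := by positivity
  refine ⟨{p | ‖p.1‖ < R}, ?_, by simp [R], ?_⟩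
  · exact isOpen_lt (continuous_norm.comp continuous_fst) continuous_const
  refine continuousOn_of_uniform_approx_of_continuousOn fun u hu => ?_
  obtain ⟨η, hη, hηu⟩ := Metric.mem_uniformity_dist.1 hu
  set C := R ^ (a + a - β) * L ^ β
  have hlim : Tendsto (fun ε : ℝ => C * ε ^ (κ * β - 2 * b)) (𝓝[>] 0) (𝓝 0) := by
    have h0 : 0 < κ * β - 2 * b := by linarith
    have := ((Real.continuous_rpow_const h0.le).tendsto 0).const_mul C
    rw [Real.zero_rpow h0.ne', mul_zero] at this
    exact this.mono_left nhdsWithin_le_nhds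
  obtain ⟨ε, hεη, hε⟩ :=
    ((hlim.eventually_lt_const (show 0 < η ^ 2 by positivity)).and self_mem_nhdsWithin).exists
  replace hε : 0 < ε := hε
  refine ⟨fun p => matPow p.1 a * cfc (fun t => max t ε ^ (-b)) p.2, ?_, ?_⟩
  · refine ContinuousOn.mul ?_ ?_
    · exact (continuousOn_matPow ha).comp continuousOn_fst fun p hp => hp.1.1
    · refine (continuousOn_cfc_posSemidef ?_).comp continuousOn_snd fun p hp => hp.1.2.1
      exact (continuous_id.max continuous_const).rpow_const
        fun t => Or.inl (lt_max_of_lt_right hε).ne'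
  · rintro ⟨ρ, σ⟩ ⟨⟨hρ, hσ, hle⟩, hR⟩
    refine hηu ?_
    have key := norm_matPow_mul_cfc_sq_le hρ hσ hL hle (le_of_lt hR) hβ hβ1 hβa
      fun t ht => suppRpow_truncation_le hb hbβ hε ht
    rw [cfc_sub _ _ σ (continuousOn_spectrum _ _) (continuousOn_spectrum _ _),
      ← matPow_eq_cfc hσ.1, mul_sub] at key
    rw [dist_eq_norm]
    exact lt_of_pow_lt_pow_left₀ 2 hη.le (key.trans_lt hεη)

end MatPow

lemma sandwich_eq {ρ σ : Matrix ι ι ℂ} (hρ : ρ.PosSemidef) (hσ : σ.PosSemidef) (a c : ℝ) :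
    matPow σ c * matPow ρ (a + a) * matPow σ c
      = (matPow ρ a * matPow σ c).conjTranspose * (matPow ρ a * matPow σ c) := by
  rw [← matPow_mul_matPow hρ, Matrix.conjTranspose_mul, (posSemidef_matPow hρ a).1.eq,
    (posSemidef_matPow hσ c).1.eq]
  simp only [mul_assoc]

lemma posSemidef_sandwich {ρ σ : Matrix ι ι ℂ} (hρ : ρ.PosSemidef) (hσ : σ.PosSemidef)
    (a c : ℝ) : (matPow σ c * matPow ρ (a + a) * matPow σ c).PosSemidef := by
  rw [sandwich_eq hρ hσ]
  exact Matrix.posSemidef_conjTranspose_mul_self _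

/-- If `α > 1` and `ρ ≤ L σ ^ κ`, the sandwiched operator depends continuously on `(ρ, σ)`
and so does `Q`. -/
lemma continuousOn_Qaz {α z κ L : ℝ} (hα : 1 < α) (hz : 0 < z) (hκ : 0 < κ)
    (hκα : (1 - κ) * α < 1) (hzκ : (α - 1) / κ < z) (hL : 0 < L) :
    ContinuousOn (fun p : Matrix ι ι ℂ × Matrix ι ι ℂ => Qaz α z p.1 p.2)
      {p | p.1.PosSemidef ∧ p.2.PosSemidef ∧ loewnerLE p.1 (L • matPow p.2 κ)} := by
  have ha : 0 < α / (2 * z) := by positivity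
  have haa : α / z = α / (2 * z) + α / (2 * z) := by field_simp; norm_num
  have hb : 0 < (α - 1) / (2 * z) := div_pos (by linarith) (by linarith)
  have hbb : (1 - α) / (2 * z) = -((α - 1) / (2 * z)) := by ring
  have hβ : 0 < min 1 (α / z) := lt_min one_pos (by positivity)
  have hbβ : 2 * ((α - 1) / (2 * z)) < κ * min 1 (α / z) := by
    have h2 : 2 * ((α - 1) / (2 * z)) = (α - 1) / z := by field_simp
    rw [h2, mul_min_of_nonneg _ _ hκ.le, lt_min_iff]
    constructor
    · rw [div_lt_iff₀ hκ] at hzκ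
      rw [div_lt_iff₀ hz]
      linarith
    · rw [← mul_div_assoc]
      gcongr
      linarith
  have hY := continuousOn_matPow_mul_matPow_neg (ι := ι) ha hb hL hβ (min_le_left _ _)
    (haa ▸ min_le_right _ _) hbβ
  have hX := (continuous_id.matrix_conjTranspose.comp_continuousOn hY).mul hY
  have hQ := (Complex.continuous_re.comp continuous_id.matrix_trace).comp_continuousOn
    ((continuousOn_matPow hz).comp hX fun p _ => Matrix.posSemidef_conjTranspose_mul_self _)
  refine hQ.congr fun p hp => ?_
  simp only [Qaz, reTrace, haa, hbb, sandwich_eq hp.1 hp.2.1]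
  rfl

lemma suppLE_of_loewnerLE {ρ σ : Matrix ι ι ℂ} (hρ : ρ.PosSemidef) (hσ : σ.PosSemidef)
    {L κ : ℝ} (h : loewnerLE ρ (L • matPow σ κ)) : suppLE ρ σ := by
  intro v hv
  have h0 : matPow σ κ = matPow σ (κ - 1) * σ := by
    conv_rhs => rw [← matPow_one hσ, matPow_matPow hσ, matPow_mul_matPow hσ]
    ring_nf
  have h1 : (L • matPow σ κ).mulVec v = 0 := by
    rw [Matrix.smul_mulVec, h0, ← Matrix.mulVec_mulVec, hv, Matrix.mulVec_zero, smul_zero]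
  have h2 := h.dotProduct_mulVec_nonneg v
  rw [Matrix.sub_mulVec, h1, zero_sub, dotProduct_neg] at h2
  exact (hρ.dotProduct_mulVec_zero_iff v).1
    (le_antisymm (neg_nonneg.1 h2) (hρ.dotProduct_mulVec_nonneg v))

lemma reTrace_pos {m : Type*} [Fintype m] {A : Matrix m m ℂ} (hA : A.PosSemidef) (hA0 : A ≠ 0) :
    0 < reTrace A := by
  have h : A.trace ≠ 0 := fun h => hA0 (hA.trace_eq_zero_iff.1 h)
  exact (Complex.pos_iff.1 (lt_of_le_of_ne hA.trace_nonneg h.symm)).1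

lemma Qaz_pos {α z : ℝ} {ρ σ : Matrix ι ι ℂ} (hρ : PSDne ρ) (hσ : σ.PosSemidef)
    (hsupp : suppLE ρ σ) : 0 < Qaz α z ρ σ := by
  have haa : α / z = α / (2 * z) + α / (2 * z) := by ring
  rw [Qaz, haa]
  have hX := posSemidef_sandwich hρ.1 hσ (α / (2 * z)) ((1 - α) / (2 * z))
  refine reTrace_pos (posSemidef_matPow hX z) ?_
  rw [Ne, matPow_eq_zero_iff hX, sandwich_eq hρ.1 hσ, Matrix.conjTranspose_mul_self_eq_zero]
  intro h0
  have h1 : matPow ρ (α / (2 * z)) * matPow σ 0 = 0 := by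
    rw [← add_neg_cancel ((1 - α) / (2 * z)), ← matPow_mul_matPow hσ, ← mul_assoc, h0, zero_mul]
  have h2 : σ * (1 - matPow σ 0) = 0 := by
    rw [mul_sub, mul_one]
    nth_rw 2 [← matPow_one hσ]
    rw [matPow_mul_matPow hσ, add_zero, matPow_one hσ, sub_self]
  have h3 : ρ * (1 - matPow σ 0) = 0 := by
    refine Matrix.ext_of_mulVec_single fun i => ?_
    rw [Matrix.zero_mulVec, ← Matrix.mulVec_mulVec]
    exact hsupp _ (by rw [Matrix.mulVec_mulVec, h2, Matrix.zero_mulVec])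
  have h4 : matPow ρ (α / (2 * z)) = matPow ρ (α / (2 * z) - 1) * ρ := by
    nth_rw 3 [← matPow_one hρ.1]
    rw [matPow_mul_matPow hρ.1, sub_add_cancel]
  have h5 : ρ = ρ * matPow σ 0 := by rwa [mul_sub, mul_one, sub_eq_zero] at h3
  refine hρ.2 ((matPow_eq_zero_iff hρ.1 (α / (2 * z))).1 ?_)
  calc matPow ρ (α / (2 * z)) = matPow ρ (α / (2 * z) - 1) * (ρ * matPow σ 0) := by
        rw [← h5, h4]
    _ = 0 := by rw [← mul_assoc, ← h4, h1]

lemma Daz_eq {α z : ℝ} {ρ σ : Matrix ι ι ℂ} (hρ : PSDne ρ) (hσ : σ.PosSemidef)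
    (hsupp : suppLE ρ σ) : Daz α z ρ σ =
      (((α - 1)⁻¹ * (Real.log (Qaz α z ρ σ) - Real.log (reTrace ρ)) : ℝ) : EReal) :=
  if_pos ⟨Or.inl hsupp, (Qaz_pos hρ hσ hsupp).ne'⟩

lemma continuousOn_Daz {n : ℕ} {α z κ L : ℝ} (hα : 1 < α) (hz : 0 < z) (hκ : 0 < κ)
    (hκα : (1 - κ) * α < 1) (hzκ : (α - 1) / κ < z) (hL : 0 < L) :
    ContinuousOn (fun p : Matrix (Fin n) (Fin n) ℂ × Matrix (Fin n) (Fin n) ℂ =>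
      Daz α z p.1 p.2) (BsetLK n L κ) := by
  have hQ := (continuousOn_Qaz (ι := Fin n) hα hz hκ hκα hzκ hL).mono
    (t := BsetLK n L κ) fun p hp => ⟨hp.1.1, hp.2.1.1, hp.2.2⟩
  have hs : ∀ p ∈ BsetLK n L κ, suppLE p.1 p.2 := fun p hp =>
    suppLE_of_loewnerLE hp.1.1 hp.2.1.1 hp.2.2
  have htr : ContinuousOn (fun p : Matrix (Fin n) (Fin n) ℂ × Matrix (Fin n) (Fin n) ℂ =>
      reTrace p.1) (BsetLK n L κ) :=
    (Complex.continuous_re.comp continuous_fst.matrix_trace).continuousOn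
  refine (continuous_coe_real_ereal.comp_continuousOn ((continuousOn_const (c := (α - 1)⁻¹)).mul
    ((hQ.log fun p hp => (Qaz_pos hp.1 hp.2.1.1 (hs p hp)).ne').sub
      (htr.log fun p hp => (reTrace_pos hp.1.1 hp.1.2).ne')))).congr fun p hp => ?_
  exact Daz_eq hp.1 hp.2.1.1 (hs p hp)

section RankOne

/-- The rank-one matrix `v vᵀ` of a real vector `v`. -/
def rankOne (v : ι → ℝ) : Matrix ι ι ℂ :=
  Matrix.vecMulVec (fun i => (v i : ℂ)) (fun i => (v i : ℂ))

lemma posSemidef_rankOne {m : Type*} [Fintype m] (v : m → ℝ) : (rankOne v).PosSemidef := by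
  convert Matrix.posSemidef_vecMulVec_self_star (fun i => (v i : ℂ)) using 1
  simp [rankOne, Pi.star_def]

lemma trace_rankOne {m : Type*} [Fintype m] (v : m → ℝ) :
    (rankOne v).trace = ((∑ i, v i * v i : ℝ) : ℂ) := by
  simp [rankOne, Matrix.trace_vecMulVec, dotProduct]

lemma rankOne_mul_self {m : Type*} [Fintype m] (v : m → ℝ) :
    rankOne v * rankOne v = (∑ i, v i * v i) • rankOne v := by
  ext i j
  simp only [rankOne, Matrix.mul_apply, Matrix.vecMulVec_apply, Matrix.smul_apply,
    Complex.real_smul, Complex.ofReal_sum, Complex.ofReal_mul, Finset.sum_mul]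
  exact Finset.sum_congr rfl fun k _ => by ring

lemma diagonal_mul_rankOne_mul_diagonal (d v : ι → ℝ) :
    Matrix.diagonal (fun i => (d i : ℂ)) * rankOne v * Matrix.diagonal (fun i => (d i : ℂ))
      = rankOne (fun i => d i * v i) := by
  ext i j
  simp only [rankOne, Matrix.mul_diagonal, Matrix.diagonal_mul, Matrix.vecMulVec_apply,
    Complex.ofReal_mul]
  ring

lemma isIdempotentElem_inv_smul_rankOne {v : ι → ℝ} (hv : 0 < ∑ i, v i * v i) :
    IsIdempotentElem ((∑ i, v i * v i)⁻¹ • rankOne v) := by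
  rw [IsIdempotentElem, smul_mul_smul_comm, rankOne_mul_self, smul_smul, mul_assoc,
    inv_mul_cancel₀ hv.ne', mul_one]

lemma matPow_of_isIdempotentElem {P : Matrix ι ι ℂ} (hP : P.PosSemidef)
    (hPP : IsIdempotentElem P) (x : ℝ) : matPow P x = P := by
  rw [matPow_eq_cfc hP.1]
  conv_rhs => rw [← matPow_one hP, matPow_eq_cfc hP.1]
  refine cfc_congr fun t ht => ?_
  rcases hPP.spectrum_subset ℝ ht with rfl | rfl <;> simp [suppRpow]

lemma matPow_rankOne {v : ι → ℝ} (hv : 0 < ∑ i, v i * v i) (x : ℝ) :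
    matPow (rankOne v) x = (∑ i, v i * v i) ^ (x - 1) • rankOne v := by
  have hP := posSemidef_real_smul (posSemidef_rankOne v) (inv_nonneg.2 hv.le)
  have h := matPow_smul hP hv.le x
  rwa [smul_smul, mul_inv_cancel₀ hv.ne', one_smul,
    matPow_of_isIdempotentElem hP (isIdempotentElem_inv_smul_rankOne hv), smul_smul,
    suppRpow_of_ne _ hv.ne', ← div_eq_mul_inv, ← Real.rpow_sub_one hv.ne'] at h

lemma loewnerLE_smul_rankOne {v : ι → ℝ} (hv : 0 < ∑ i, v i * v i) {μ L : ℝ} (hμ : 0 ≤ μ)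
    (hL : μ * ∑ i, v i * v i ≤ L) :
    loewnerLE (μ • rankOne v) (L • (1 : Matrix ι ι ℂ)) := by
  set w := ∑ i, v i * v i
  set P := w⁻¹ • rankOne v with hPdef
  have hP : P.PosSemidef := posSemidef_real_smul (posSemidef_rankOne v) (inv_nonneg.2 hv.le)
  have hQ : (1 - P).PosSemidef := by
    have h1 := Matrix.posSemidef_conjTranspose_mul_self (1 - P)
    rwa [Matrix.conjTranspose_sub, hP.1.eq, Matrix.conjTranspose_one,
      (isIdempotentElem_inv_smul_rankOne hv).one_sub.eq] at h1
  have hv' : rankOne v = w • P := by rw [hPdef, smul_smul, mul_inv_cancel₀ hv.ne', one_smul]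
  have key : L • (1 : Matrix ι ι ℂ) - μ • rankOne v
      = (L - μ * w) • (1 : Matrix ι ι ℂ) + (μ * w) • (1 - P) := by
    rw [hv', smul_smul, sub_smul, smul_sub]
    abel
  rw [loewnerLE, key]
  exact (posSemidef_real_smul Matrix.PosSemidef.one (sub_nonneg.2 hL)).add
    (posSemidef_real_smul hQ (mul_nonneg hμ hv.le))

lemma loewnerLE_smul_rankOne_diagonal {v : ι → ℝ} (hv : 0 < ∑ i, v i * v i) {μ L : ℝ}
    (hμ : 0 ≤ μ) (hL : μ * ∑ i, v i * v i ≤ L) (d : ι → ℝ) :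
    loewnerLE (μ • rankOne (fun i => d i * v i))
      (L • Matrix.diagonal (fun i => ((d i * d i : ℝ) : ℂ))) := by
  have h := (loewnerLE_smul_rankOne hv hμ hL).conjTranspose_mul_mul_same
    (Matrix.diagonal (fun i => (d i : ℂ)))
  have hd : (Matrix.diagonal (fun i => (d i : ℂ))).conjTranspose
      = Matrix.diagonal (fun i => (d i : ℂ)) := by
    simp [Matrix.diagonal_conjTranspose, Pi.star_def]
  rw [hd, mul_sub, sub_mul, mul_smul_comm, mul_smul_comm, smul_mul_assoc, smul_mul_assoc,
    diagonal_mul_rankOne_mul_diagonal, mul_one, Matrix.diagonal_mul_diagonal] at h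
  simpa only [loewnerLE, Complex.ofReal_mul] using h

lemma isHermitian_diagonal_ofReal {m : Type*} [DecidableEq m] (d : m → ℝ) :
    (Matrix.diagonal (fun i => (d i : ℂ))).IsHermitian :=
  Matrix.isHermitian_diagonal_of_self_adjoint _ (by
    ext i
    simp)

lemma matPow_diagonal (d : ι → ℝ) (x : ℝ) :
    matPow (Matrix.diagonal (fun i => (d i : ℂ))) x
      = Matrix.diagonal (fun i => (suppRpow x (d i) : ℂ)) := by
  have hA := isHermitian_diagonal_ofReal d
  set A := Matrix.diagonal (fun i => (d i : ℂ))
  have hfin : (spectrum ℝ A ∪ range d).Finite := A.finite_real_spectrum.union (finite_range d)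
  set q := Lagrange.interpolate hfin.toFinset id (suppRpow x)
  have hq : ∀ t ∈ spectrum ℝ A ∪ range d, q.eval t = suppRpow x t := fun t ht =>
    Lagrange.eval_interpolate_at_node _ (injOn_id _) (hfin.mem_toFinset.2 ht)
  have h1 : cfc (suppRpow x) A = Polynomial.aeval A q :=
    (cfc_congr fun t ht => (hq t (Or.inl ht)).symm).trans (cfc_polynomial q A hA)
  have h2 : Polynomial.aeval A q
      = Matrix.diagonal (Polynomial.aeval (fun i => (d i : ℂ)) q) :=
    Polynomial.aeval_algHom_apply (Matrix.diagonalAlgHom ℝ) (fun i => (d i : ℂ)) q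
  rw [matPow_eq_cfc hA, h1, h2]
  congr 1
  ext i
  rw [Polynomial.aeval_pi_apply₂, ← hq (d i) (Or.inr ⟨i, rfl⟩)]
  exact Polynomial.aeval_algebraMap_apply_eq_algebraMap_eval (A := ℂ) (d i) q

lemma Qaz_rankOne_diagonal {α z μ w : ℝ} (hμ : 0 < μ) (hz : 0 < z) {s v : ι → ℝ}
    (hs : ∀ i, 0 ≤ s i) (hv : ∑ i, v i * v i = 1)
    (hw : ∑ i, suppRpow ((1 - α) / z) (s i) * (v i * v i) = w) (hw0 : 0 < w) :
    Qaz α z (μ • rankOne v) (Matrix.diagonal (fun i => (s i : ℂ))) = μ ^ α * w ^ z := by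
  have hρ : matPow (μ • rankOne v) (α / z) = μ ^ (α / z) • rankOne v := by
    rw [matPow_smul (posSemidef_rankOne v) hμ.le, matPow_rankOne (by rw [hv]; exact one_pos), hv,
      Real.one_rpow, one_smul, suppRpow_of_ne _ hμ.ne']
  set u : ι → ℝ := fun i => suppRpow ((1 - α) / (2 * z)) (s i) * v i
  have hu : ∑ i, u i * u i = w := by
    rw [← hw]
    refine Finset.sum_congr rfl fun i _ => ?_
    rw [mul_mul_mul_comm, suppRpow_mul_suppRpow _ _ (hs i)]
    congr 2
    field_simp
    norm_num
  have hμz : 0 < μ ^ (α / z) := Real.rpow_pos_of_pos hμ _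
  rw [Qaz, hρ, matPow_diagonal, mul_smul_comm, smul_mul_assoc,
    diagonal_mul_rankOne_mul_diagonal, matPow_smul (posSemidef_rankOne _) hμz.le,
    matPow_rankOne (hu ▸ hw0), smul_smul, reTrace, Matrix.trace_smul, trace_rankOne, hu,
    Complex.real_smul, ← Complex.ofReal_mul, Complex.ofReal_re, suppRpow_of_ne _ hμz.ne',
    ← Real.rpow_mul hμ.le, div_mul_cancel₀ _ hz.ne', mul_assoc, ← Real.rpow_add_one hw0.ne',
    sub_add_cancel]

end RankOne

section TwoLevel

/-- The vector with entry `a` at `i₀`, `b` at `i₁` and `0` elsewhere. -/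
def pairVec (i₀ i₁ : ι) (a b : ℝ) : ι → ℝ :=
  fun i => if i = i₀ then a else if i = i₁ then b else 0

lemma pairVec_nonneg {m : Type*} [DecidableEq m] (i₀ i₁ : m) {a b : ℝ}
    (ha : 0 ≤ a) (hb : 0 ≤ b) (i : m) :
    0 ≤ pairVec i₀ i₁ a b i := by
  unfold pairVec
  split_ifs <;> simp [ha, hb]

lemma pairVec_le {m : Type*} [DecidableEq m] {i₀ i₁ : m} {a b c : ℝ}
    (ha : a ≤ c) (hb : b ≤ c) (hc : 0 ≤ c) (i : m) :
    pairVec i₀ i₁ a b i ≤ c := by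
  unfold pairVec
  split_ifs <;> simp [ha, hb, hc]

lemma pairVec_mul {m : Type*} [DecidableEq m] (i₀ i₁ : m) (a b a' b' : ℝ)
    (i : m) :
    pairVec i₀ i₁ a b i * pairVec i₀ i₁ a' b' i = pairVec i₀ i₁ (a * a') (b * b') i := by
  unfold pairVec
  split_ifs <;> simp

lemma suppRpow_pairVec {m : Type*} [DecidableEq m] (i₀ i₁ : m) (x a b : ℝ)
    (i : m) :
    suppRpow x (pairVec i₀ i₁ a b i) = pairVec i₀ i₁ (suppRpow x a) (suppRpow x b) i := by
  unfold pairVec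
  split_ifs <;> simp [suppRpow_zero_right]

lemma sum_pairVec {i₀ i₁ : ι} (h : i₀ ≠ i₁) (a b : ℝ) : ∑ i, pairVec i₀ i₁ a b i = a + b := by
  rw [Fintype.sum_eq_add i₀ i₁ h fun i hi => by simp [pairVec, hi.1, hi.2]]
  simp [pairVec, h.symm]

/-- The pair `(μ |ψ⟩⟨ψ|, σ)` with `ψ = (a, b)` and `σ = diag (x, y)` supported on two
basis vectors. -/
def twoLevelPair (i₀ i₁ : ι) (μ a b x y : ℝ) : Matrix ι ι ℂ × Matrix ι ι ℂ :=
  (μ • rankOne (pairVec i₀ i₁ a b), Matrix.diagonal fun i => (pairVec i₀ i₁ x y i : ℂ))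

lemma trace_twoLevelPair_fst {i₀ i₁ : ι} (h : i₀ ≠ i₁) (μ a b x y : ℝ) :
    (twoLevelPair i₀ i₁ μ a b x y).1.trace = ((μ * (a * a + b * b) : ℝ) : ℂ) := by
  simp only [twoLevelPair, Matrix.trace_smul, trace_rankOne, pairVec_mul, sum_pairVec h,
    Complex.real_smul, Complex.ofReal_mul]

lemma trace_twoLevelPair_snd {i₀ i₁ : ι} (h : i₀ ≠ i₁) (μ a b x y : ℝ) :
    (twoLevelPair i₀ i₁ μ a b x y).2.trace = ((x + y : ℝ) : ℂ) := by
  rw [twoLevelPair, Matrix.trace_diagonal, ← Complex.ofReal_sum, sum_pairVec h]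

lemma posSemidef_diagonal_ofReal {m : Type*} [DecidableEq m] {d : m → ℝ} (hd : ∀ i, 0 ≤ d i) :
    (Matrix.diagonal fun i => (d i : ℂ)).PosSemidef :=
  Matrix.PosSemidef.diagonal fun i => Complex.zero_le_real.2 (hd i)

lemma psdne_of_trace {m : Type*} [Fintype m] {A : Matrix m m ℂ} (hA : A.PosSemidef) {t : ℝ}
    (ht : 0 < t) (h : A.trace = (t : ℂ)) : PSDne A := by
  refine ⟨hA, ?_⟩
  rintro rfl
  rw [Matrix.trace_zero] at h
  exact ht.ne' (by exact_mod_cast h.symm)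

lemma psdne_twoLevelPair {i₀ i₁ : ι} (h : i₀ ≠ i₁) {μ a b x y : ℝ} (hμ : 0 < μ)
    (hab : a * a + b * b = 1) (hx : 0 < x) (hy : 0 ≤ y) :
    PSDne (twoLevelPair i₀ i₁ μ a b x y).1 ∧ PSDne (twoLevelPair i₀ i₁ μ a b x y).2 :=
  ⟨psdne_of_trace (posSemidef_real_smul (posSemidef_rankOne _) hμ.le) (by rwa [hab, mul_one])
      (trace_twoLevelPair_fst h μ a b x y),
    psdne_of_trace (posSemidef_diagonal_ofReal (pairVec_nonneg _ _ hx.le hy)) (by positivity)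
      (trace_twoLevelPair_snd h μ a b x y)⟩

lemma twoLevelPair_mem_BsetLK {n : ℕ} {i₀ i₁ : Fin n} (h : i₀ ≠ i₁) {μ x y p q κ lam : ℝ}
    (hμ : 0 < μ) (hκ : 0 < κ) (hx : 0 < x) (hy : 0 ≤ y) (hp : 0 ≤ p) (hq : 0 < q)
    (hsum : x ^ κ * p + y ^ κ * q = 1) (hle : μ * (p + q) ≤ lam) :
    twoLevelPair i₀ i₁ μ √(x ^ κ * p) √(y ^ κ * q) x y ∈ BsetLK n lam κ := by
  have hxκ : 0 ≤ x ^ κ := by positivity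
  have hyκ : 0 ≤ y ^ κ := by positivity
  obtain ⟨h1, h2⟩ := psdne_twoLevelPair (y := y) (a := √(x ^ κ * p)) (b := √(y ^ κ * q)) h hμ
    (by rw [Real.mul_self_sqrt (by positivity), Real.mul_self_sqrt (by positivity), hsum]) hx hy
  refine ⟨h1, h2, ?_⟩
  have hv : ∑ i, pairVec i₀ i₁ √p √q i * pairVec i₀ i₁ √p √q i = p + q := by
    simp only [pairVec_mul, sum_pairVec h, Real.mul_self_sqrt hp, Real.mul_self_sqrt hq.le]
  have key := loewnerLE_smul_rankOne_diagonal (v := pairVec i₀ i₁ √p √q) (L := lam)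
    (by rw [hv]; positivity) hμ.le (by rwa [hv]) (pairVec i₀ i₁ √(x ^ κ) √(y ^ κ))
  simp only [pairVec_mul, Real.mul_self_sqrt hxκ, Real.mul_self_sqrt hyκ, ← Real.sqrt_mul hxκ,
    ← Real.sqrt_mul hyκ] at key
  simpa only [twoLevelPair, matPow_diagonal, suppRpow_pairVec, suppRpow_eq_rpow hκ.ne'] using key

lemma Daz_twoLevelPair {n : ℕ} {i₀ i₁ : Fin n} (h : i₀ ≠ i₁) {α z μ a b x y lam κ : ℝ}
    (hα : 1 < α) (hz : 0 < z) (hμ : 0 < μ) (hab : a * a + b * b = 1) (ha : 0 < a)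
    (hx : 0 < x) (hy : 0 ≤ y) (hmem : twoLevelPair i₀ i₁ μ a b x y ∈ BsetLK n lam κ) :
    Daz α z (twoLevelPair i₀ i₁ μ a b x y).1 (twoLevelPair i₀ i₁ μ a b x y).2 =
      ((Real.log μ + (α - 1)⁻¹ * z * Real.log (suppRpow ((1 - α) / z) x * (a * a) +
        suppRpow ((1 - α) / z) y * (b * b)) : ℝ) : EReal) := by
  have hα' : α - 1 ≠ 0 := by linarith
  have hw : 0 < suppRpow ((1 - α) / z) x * (a * a) + suppRpow ((1 - α) / z) y * (b * b) := by
    rw [suppRpow_of_ne _ hx.ne']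
    have := mul_nonneg (suppRpow_nonneg ((1 - α) / z) hy) (mul_self_nonneg b)
    positivity
  have hQ : Qaz α z (twoLevelPair i₀ i₁ μ a b x y).1 (twoLevelPair i₀ i₁ μ a b x y).2 = _ :=
    Qaz_rankOne_diagonal hμ hz (pairVec_nonneg i₀ i₁ hx.le hy) (v := pairVec i₀ i₁ a b)
      (by simp only [pairVec_mul, sum_pairVec h, hab])
      (by simp only [suppRpow_pairVec, pairVec_mul, sum_pairVec h]) hw
  rw [Daz_eq hmem.1 hmem.2.1.1 (suppLE_of_loewnerLE hmem.1.1 hmem.2.1.1 hmem.2.2), hQ, reTrace,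
    trace_twoLevelPair_fst h, hab, mul_one, Complex.ofReal_re,
    Real.log_mul (by positivity) (by positivity), Real.log_rpow hμ, Real.log_rpow hw]
  congr 1
  field_simp
  ring

lemma continuousAt_twoLevelPair {m : Type*} [DecidableEq m] (i₀ i₁ : m) (μ : ℝ)
    {a b x y : ℝ → ℝ} {t : ℝ}
    (ha : ContinuousAt a t) (hb : ContinuousAt b t) (hx : ContinuousAt x t)
    (hy : ContinuousAt y t) :
    ContinuousAt (fun ε => twoLevelPair i₀ i₁ μ (a ε) (b ε) (x ε) (y ε)) t := by
  have hvec : ∀ {f g : ℝ → ℝ}, ContinuousAt f t → ContinuousAt g t → ∀ i,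
      ContinuousAt (fun ε => (pairVec i₀ i₁ (f ε) (g ε) i : ℂ)) t := fun hf hg i => by
    refine Complex.continuous_ofReal.continuousAt.comp ?_
    unfold pairVec
    split_ifs <;> first | assumption | exact continuousAt_const
  refine ContinuousAt.prodMk (ContinuousAt.const_smul ?_ μ) ?_
  · exact continuousAt_pi.2 fun i => continuousAt_pi.2 fun j =>
      (hvec ha hb i).mul (hvec ha hb j)
  · exact continuous_id.matrix_diagonal.continuousAt.comp (continuousAt_pi.2 (hvec hx hy))

/-- If `κ ≤ γ` with `γ = (α - 1) / z`, moving weight `s ε ^ κ` of the state to an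
eigenvector of `σ` with eigenvalue `c ε` raises its weighted overlap by a fixed factor. -/
lemma jump_le {c s κ γ ε : ℝ} (hc : 0 < c) (hs : 0 < s) (hγ : κ ≤ γ) (hγ0 : 0 < γ)
    (hε : 0 < ε) (hε1 : ε < 1) (hsε : s * ε ^ κ < 1) (hε2 : ε ^ κ ≤ 1 / 2) :
    c ^ (-γ) * (1 + s / 2) ≤
      (c * (1 - ε)) ^ (-γ) * (1 - s * ε ^ κ) + (c * ε) ^ (-γ) * (s * ε ^ κ) := by
  have h1 : c ^ (-γ) ≤ (c * (1 - ε)) ^ (-γ) :=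
    Real.rpow_le_rpow_of_nonpos (mul_pos hc (by linarith)) (by nlinarith) (by linarith)
  have h2 : 1 ≤ ε ^ (-γ) * ε ^ κ := by
    rw [← Real.rpow_add hε]
    exact Real.one_le_rpow_of_pos_of_le_one_of_nonpos hε hε1.le (by linarith)
  have hcγ : 0 < c ^ (-γ) := by positivity
  calc c ^ (-γ) * (1 + s / 2) ≤ c ^ (-γ) * (1 - s * ε ^ κ) + c ^ (-γ) * (s * 1) := by
        rw [← mul_add]
        exact mul_le_mul_of_nonneg_left (by nlinarith) hcγ.le
    _ ≤ (c * (1 - ε)) ^ (-γ) * (1 - s * ε ^ κ)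
          + c ^ (-γ) * (s * (ε ^ (-γ) * ε ^ κ)) := by
        exact add_le_add (mul_le_mul_of_nonneg_right h1 (by linarith)) (by gcongr)
    _ = _ := by
        rw [Real.mul_rpow hc.le hε.le]
        ring

lemma lt_of_continuousOn_Daz {n : ℕ} {i₀ i₁ : Fin n} (h : i₀ ≠ i₁) {α z μ c lam κ : ℝ}
    (hα : 1 < α) (hz : 0 < z) (hκ : 0 < κ) (hμ : 0 < μ) (hc : 0 < c) (hlam : μ < lam * c ^ κ)
    {S : Set (Matrix (Fin n) (Fin n) ℂ × Matrix (Fin n) (Fin n) ℂ)}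
    (hS : ∀ a b x y : ℝ, 0 ≤ x → 0 ≤ y → x + y = c → a * a + b * b = 1 →
      twoLevelPair i₀ i₁ μ a b x y ∈ BsetLK n lam κ → twoLevelPair i₀ i₁ μ a b x y ∈ S)
    (hcont : ContinuousOn (fun p : Matrix (Fin n) (Fin n) ℂ × Matrix (Fin n) (Fin n) ℂ =>
      Daz α z p.1 p.2) S) : (α - 1) / κ < z := by
  by_contra! hzκ
  have hγ : κ ≤ (α - 1) / z := by
    rw [le_div_iff₀ hκ] at hzκ
    rw [le_div_iff₀ hz]
    linarith
  have hγ0 : 0 < (α - 1) / z := hκ.trans_le hγ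
  have hneg : (1 - α) / z = -((α - 1) / z) := by ring
  have hcκ : 0 < c ^ κ := by positivity
  obtain ⟨s, hs, hsl⟩ : ∃ s : ℝ, 0 < s ∧ μ * (1 + s) < lam * c ^ κ := by
    refine ⟨(lam * c ^ κ - μ) / (2 * μ), div_pos (by linarith) (by linarith), ?_⟩
    have : μ * (1 + (lam * c ^ κ - μ) / (2 * μ)) = (lam * c ^ κ + μ) / 2 := by
      field_simp
      ring
    linarith
  have hpow : Continuous fun ε : ℝ => ε ^ κ := Real.continuous_rpow_const hκ.le
  have hsmall : ∀ᶠ ε in 𝓝 (0 : ℝ), s * ε ^ κ < 1 :=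
    ((continuous_const.mul hpow).tendsto' 0 0
      (by simp [Real.zero_rpow hκ.ne'])).eventually_lt_const one_pos
  have hhalf : ∀ᶠ ε in 𝓝 (0 : ℝ), ε ^ κ < 1 / 2 :=
    (hpow.tendsto' 0 0 (Real.zero_rpow hκ.ne')).eventually_lt_const (by norm_num)
  set x : ℝ → ℝ := fun ε => c * (1 - ε)
  set y : ℝ → ℝ := fun ε => c * ε
  set p : ℝ → ℝ := fun ε => (1 - s * ε ^ κ) / x ε ^ κ
  set q : ℝ := s / c ^ κ
  have hq : 0 < q := by positivity
  have hxc : Continuous x := by fun_prop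
  have hyc : Continuous y := by fun_prop
  have hxκ : Continuous fun ε => x ε ^ κ := hpow.comp hxc
  have hx0 : x 0 = c := by simp [x]
  have hp : ContinuousAt p 0 :=
    ((continuous_const.sub (continuous_const.mul hpow)).continuousAt).div hxκ.continuousAt
      (by simp only [hx0]; exact hcκ.ne')
  have hp0 : p 0 = 1 / c ^ κ := by simp [p, hx0, Real.zero_rpow hκ.ne']
  set P := fun ε => twoLevelPair i₀ i₁ μ √(x ε ^ κ * p ε) √(y ε ^ κ * q) (x ε) (y ε)
  have hP : ContinuousAt P 0 := continuousAt_twoLevelPair i₀ i₁ μ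
    (hxκ.continuousAt.mul hp).sqrt
    ((hpow.comp hyc).continuousAt.mul continuousAt_const).sqrt hxc.continuousAt hyc.continuousAt
  set w : ℝ → ℝ := fun ε => suppRpow ((1 - α) / z) (x ε) * (1 - s * ε ^ κ)
    + suppRpow ((1 - α) / z) (y ε) * (s * ε ^ κ)
  have hgood : ∀ᶠ ε in 𝓝[≥] (0 : ℝ), P ε ∈ S ∧ Daz α z (P ε).1 (P ε).2
      = ((Real.log μ + (α - 1)⁻¹ * z * Real.log (w ε) : ℝ) : EReal) := by
    have hle : ∀ᶠ ε in 𝓝 (0 : ℝ), μ * (p ε + q) < lam := by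
      refine (continuousAt_const.mul (hp.add continuousAt_const)).eventually_lt
        continuousAt_const ?_
      change μ * (p 0 + q) < lam
      rw [hp0, ← add_div, ← mul_div_assoc, div_lt_iff₀ hcκ]
      exact hsl
    filter_upwards [self_mem_nhdsWithin, nhdsWithin_le_nhds (eventually_lt_nhds one_pos),
      nhdsWithin_le_nhds hsmall, nhdsWithin_le_nhds hle] with ε hε h1 h2 h3
    replace hε : 0 ≤ ε := hε
    have hxp : 0 < x ε := mul_pos hc (by linarith)
    have hyp : 0 ≤ y ε := mul_nonneg hc.le hε
    have hxk : x ε ^ κ * p ε = 1 - s * ε ^ κ :=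
      mul_div_cancel₀ _ (Real.rpow_pos_of_pos hxp κ).ne'
    have hyk : y ε ^ κ * q = s * ε ^ κ := by
      simp only [y, q, Real.mul_rpow hc.le hε]
      field_simp
    have hyk0 : 0 ≤ s * ε ^ κ := by positivity
    have hpp : 0 ≤ p ε := div_nonneg (by linarith) (by positivity)
    have hmem := twoLevelPair_mem_BsetLK h hμ hκ hxp hyp hpp hq
      (by rw [hxk, hyk, sub_add_cancel]) h3.le
    have ha : √(x ε ^ κ * p ε) * √(x ε ^ κ * p ε) = 1 - s * ε ^ κ := by
      rw [hxk, Real.mul_self_sqrt (by linarith)]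
    have hb : √(y ε ^ κ * q) * √(y ε ^ κ * q) = s * ε ^ κ := by
      rw [hyk, Real.mul_self_sqrt hyk0]
    have hab : √(x ε ^ κ * p ε) * √(x ε ^ κ * p ε) + √(y ε ^ κ * q) * √(y ε ^ κ * q) = 1 := by
      rw [ha, hb, sub_add_cancel]
    refine ⟨hS _ _ _ _ hxp.le hyp (by simp only [x, y]; ring) hab hmem, ?_⟩
    rw [Daz_twoLevelPair h hα hz hμ hab (Real.sqrt_pos.2 (by rw [hxk]; linarith)) hxp hyp hmem,
      ha, hb]
  have hw0 : w 0 = c ^ (-((α - 1) / z)) := by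
    simp only [w, hx0, Real.zero_rpow hκ.ne', suppRpow_of_ne _ hc.ne', hneg]
    ring
  obtain ⟨hP0, hD0⟩ := hgood.self_of_nhdsWithin self_mem_Ici
  have hlim : Tendsto (fun ε => Daz α z (P ε).1 (P ε).2) (𝓝[≥] 0)
      (𝓝 (Daz α z (P 0).1 (P 0).2)) :=
    (hcont (P 0) hP0).tendsto.comp (tendsto_nhdsWithin_iff.2
      ⟨hP.tendsto.mono_left nhdsWithin_le_nhds, hgood.mono fun _ hε => hε.1⟩)
  have hK : 0 < (α - 1)⁻¹ * z := mul_pos (inv_pos.2 (by linarith)) hz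
  rw [hD0, hw0] at hlim
  have hlt : ∀ᶠ ε in 𝓝[>] (0 : ℝ), Daz α z (P ε).1 (P ε).2 < ((Real.log μ + (α - 1)⁻¹ * z *
      Real.log (c ^ (-((α - 1) / z)) * (1 + s / 2)) : ℝ) : EReal) := by
    refine (hlim.mono_left (nhdsWithin_mono _ Ioi_subset_Ici_self)).eventually_lt_const ?_
    rw [EReal.coe_lt_coe_iff]
    have hcγ : 0 < c ^ (-((α - 1) / z)) := by positivity
    gcongr
    nlinarith
  obtain ⟨ε, hlt, hε, ⟨-, hD⟩, h1, h2, h3⟩ := (hlt.and (eventually_mem_nhdsWithin.and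
    ((hgood.filter_mono (nhdsWithin_mono _ Ioi_subset_Ici_self)).and
      (((eventually_lt_nhds one_pos).and (hsmall.and hhalf)).filter_mono
        nhdsWithin_le_nhds)))).exists
  replace hε : 0 < ε := hε
  rw [hD, EReal.coe_lt_coe_iff] at hlt
  refine hlt.not_ge ?_
  have hjump := jump_le hc hs hγ hγ0 hε h1 h2 h3.le
  rw [← hneg, ← suppRpow_of_ne _ (mul_pos hc (sub_pos.2 h1)).ne',
    ← suppRpow_of_ne ((1 - α) / z) (mul_pos hc hε).ne', hneg] at hjump
  gcongr
  simpa only [w, x, y, hneg] using hjump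

lemma twoLevelPair_mem_CsetLK {n : ℕ} {i₀ i₁ : Fin n} (h : i₀ ≠ i₁) {μ c lam κ a b x y : ℝ}
    (hμ : 0 ≤ μ) (hμc : μ ≤ c) (hx : 0 ≤ x) (hy : 0 ≤ y) (hxy : x + y = c)
    (hab : a * a + b * b = 1) (hmem : twoLevelPair i₀ i₁ μ a b x y ∈ BsetLK n lam κ) :
    twoLevelPair i₀ i₁ μ a b x y ∈ CsetLK n lam κ c := by
  have hv : ∑ i, pairVec i₀ i₁ a b i * pairVec i₀ i₁ a b i = 1 := by
    simp only [pairVec_mul, sum_pairVec h, hab]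
  refine ⟨hmem, loewnerLE_smul_rankOne (by rw [hv]; exact one_pos) hμ (by rwa [hv, mul_one]), ?_⟩
  have hd : c • (1 : Matrix (Fin n) (Fin n) ℂ) - (twoLevelPair i₀ i₁ μ a b x y).2
      = Matrix.diagonal fun i => ((c - pairVec i₀ i₁ x y i : ℝ) : ℂ) := by
    ext i j
    rcases eq_or_ne i j with rfl | hij
    · simp [twoLevelPair]
    · simp [twoLevelPair, hij]
  rw [loewnerLE, hd]
  exact posSemidef_diagonal_ofReal fun i =>
    sub_nonneg.2 (pairVec_le (by linarith) (by linarith) (hμ.trans hμc) i)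

end TwoLevel

/-- For `dim ℋ ≥ 2`, `κ > 0`, `α > 1` with `(1-κ)α < 1` and `z > 0`,
the eight continuity conditions for `D_{α,z}` are equivalent, and equivalent to
`z > (α-1)/κ`. -/
theorem renyi_az_continuity_tfae {n : ℕ} (hn : 2 ≤ n) (κ α z : ℝ)
    (hκ : 0 < κ) (hα : 1 < α) (hκα : (1 - κ) * α < 1) (hz : 0 < z) :
    List.TFAE [
      ∀ lam κ' : ℝ, 0 < lam → κ ≤ κ' →
        ContinuousOn (fun p : Matrix (Fin n) (Fin n) ℂ × Matrix (Fin n) (Fin n) ℂ =>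
          Daz α z p.1 p.2) (BsetLK n lam κ'),
      ∀ lam : ℝ, 0 < lam →
        ContinuousOn (fun p : Matrix (Fin n) (Fin n) ℂ × Matrix (Fin n) (Fin n) ℂ =>
          Daz α z p.1 p.2) (BsetLK n lam κ),
      ∃ lam : ℝ, 0 < lam ∧
        ContinuousOn (fun p : Matrix (Fin n) (Fin n) ℂ × Matrix (Fin n) (Fin n) ℂ =>
          Daz α z p.1 p.2) (BsetLK n lam κ),
      ∀ lam c : ℝ, 0 < lam → 0 < c →
        ContinuousOn (fun p : Matrix (Fin n) (Fin n) ℂ × Matrix (Fin n) (Fin n) ℂ =>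
          Daz α z p.1 p.2) (CsetLK n lam κ c),
      ∃ lam c : ℝ, 0 < lam ∧ 0 < c ∧
        ContinuousOn (fun p : Matrix (Fin n) (Fin n) ℂ × Matrix (Fin n) (Fin n) ℂ =>
          Daz α z p.1 p.2) (CsetLK n lam κ c),
      ∀ lam : ℝ, 1 < lam →
        ContinuousOn (fun p : Matrix (Fin n) (Fin n) ℂ × Matrix (Fin n) (Fin n) ℂ =>
          Daz α z p.1 p.2) (SsetLK n lam κ),
      ∃ lam : ℝ, 1 < lam ∧
        ContinuousOn (fun p : Matrix (Fin n) (Fin n) ℂ × Matrix (Fin n) (Fin n) ℂ =>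
          Daz α z p.1 p.2) (SsetLK n lam κ),
      (α - 1) / κ < z ] := by
  have h01 : (⟨0, by omega⟩ : Fin n) ≠ ⟨1, hn⟩ := by simp
  tfae_have 1 → 2 := fun H lam hlam => H lam κ hlam le_rfl
  tfae_have 2 → 3 := fun H => ⟨1, one_pos, H 1 one_pos⟩
  tfae_have 3 → 5 := fun ⟨lam, hlam, H⟩ => ⟨lam, 1, hlam, one_pos, H.mono fun _ hp => hp.1⟩
  tfae_have 2 → 4 := fun H lam c hlam _ => (H lam hlam).mono fun _ hp => hp.1
  tfae_have 4 → 5 := fun H => ⟨1, 1, one_pos, one_pos, H 1 1 one_pos one_pos⟩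
  tfae_have 2 → 6 := fun H lam hlam => (H lam (one_pos.trans hlam)).mono fun _ hp => hp.1
  tfae_have 6 → 7 := fun H => ⟨2, one_lt_two, H 2 one_lt_two⟩
  tfae_have 5 → 8 := by
    rintro ⟨lam, c, hlam, hc, H⟩
    have hpos : 0 < lam * c ^ κ := by positivity
    have hμ : 0 < min c (lam * c ^ κ / 2) := lt_min hc (half_pos hpos)
    refine lt_of_continuousOn_Daz h01 hα hz hκ hμ hc
      ((min_le_right _ _).trans_lt (half_lt_self hpos)) ?_ H
    exact fun a b x y hx hy hxy hab hmem =>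
      twoLevelPair_mem_CsetLK h01 hμ.le (min_le_left _ _) hx hy hxy hab hmem
  tfae_have 7 → 8 := by
    rintro ⟨lam, hlam, H⟩
    refine lt_of_continuousOn_Daz h01 hα hz hκ one_pos one_pos (by simpa using hlam) ?_ H
    refine fun a b x y _ _ hxy hab hmem => ⟨hmem, ?_, ?_⟩
    · rw [trace_twoLevelPair_fst h01, hab, mul_one, Complex.ofReal_one]
    · rw [trace_twoLevelPair_snd h01, hxy, Complex.ofReal_one]
  tfae_have 8 → 1 := fun H lam κ' hlam hκ' =>
    continuousOn_Daz hα hz (hκ.trans_le hκ')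
      (lt_of_le_of_lt (by nlinarith) hκα)
      (lt_of_le_of_lt (div_le_div_of_nonneg_left (by linarith) hκ hκ') H) hlam
  tfae_finish

end QRenyi

end
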